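/- arXiv:2501.03890 — 7 statements merged into one kernel-verified Lean document; each statement's English description precedes it below -/
import Mathlib

section
/- Let C be a Q-category, S : 𝒮 → ob(C) and W : 𝒮 → Q functions, and define V : ob(C) → Q by V(x) := ⨅_{c∈𝒮} [W(c), hom_C(x, S(c))]. If the join of the identity function 1_C : ob(C) → ob(C) weighted by V exists, then it satisfies the defining universal property of the meet of S weighted by W: for all x ∈ ob(C), hom_C(x, ⋁^V 1_C) = ⨅_{c∈𝒮} [W(c), hom_C(x, S(c))]. Consequently, a Q-category has all weighted meets if it has all weighted joins (and dually, all weighted joins if it has all weighted meets). -/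
/- `Q` is a commutative unital quantale: `[CommMonoid Q] [CompleteLattice Q] [IsQuantale Q]`
(Mathlib's `IsQuantale` says multiplication distributes over arbitrary suprema).
Semicartesianness (`∀ p q, p * q ≤ p ⊓ q`) is taken as an explicit hypothesis where needed. -/

universe u v w

/-- The internal hom `[p,q] := ⨆ {r | p·r ≤ q}` of a quantale. -/
def qhom {Q : Type v} [CompleteLattice Q] [Mul Q] (p q : Q) : Q := sSup {r | p * r ≤ q}

section QCat

variable {Q : Type v} [CompleteLattice Q] [CommMonoid Q] {A : Type u}

/-- A `Q`-category structure on `A` given by a `Q`-valued hom. -/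
structure IsQCategory (hom : A → A → Q) : Prop where
  hom_self : ∀ x, hom x x = 1
  comp : ∀ x y z, hom x y * hom y z ≤ hom x z

/-- `m` is the meet of `S` weighted by `W`. -/
def IsWeightedMeet (hom : A → A → Q) {ι : Type w} (S : ι → A) (W : ι → Q) (m : A) : Prop :=
  ∀ x, hom x m = ⨅ c, qhom (W c) (hom x (S c))

/-- `j` is the join of `S` weighted by `W`. -/
def IsWeightedJoin (hom : A → A → Q) {ι : Type w} (S : ι → A) (W : ι → Q) (j : A) : Prop :=
  ∀ x, hom j x = ⨅ c, qhom (W c) (hom (S c) x)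

/-- The `Q`-category has all weighted meets. -/
def HasAllWeightedMeets (hom : A → A → Q) : Prop :=
  ∀ (ι : Type u) (S : ι → A) (W : ι → Q), ∃ m, IsWeightedMeet hom S W m

/-- The `Q`-category has all weighted joins. -/
def HasAllWeightedJoins (hom : A → A → Q) : Prop :=
  ∀ (ι : Type u) (S : ι → A) (W : ι → Q), ∃ j, IsWeightedJoin hom S W j

end QCat

theorem le_qhom_iff {Q : Type v} [CompleteLattice Q] [CommMonoid Q] [IsQuantale Q] {p q r : Q} :
    r ≤ qhom p q ↔ p * r ≤ q := by
  refine ⟨fun h => ?_, fun h => le_sSup h⟩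
  calc p * r ≤ p * qhom p q := by gcongr
    _ = ⨆ y ∈ {r | p * r ≤ q}, p * y := IsQuantale.mul_sSup_distrib _ _
    _ ≤ q := iSup₂_le fun _ hy => hy

/-- The opposite of a `Q`-category. -/
theorem IsQCategory.op {Q : Type v} [CompleteLattice Q] [CommMonoid Q] {A : Type u}
    {hom : A → A → Q} (hC : IsQCategory hom) : IsQCategory fun x y => hom y x where
  hom_self := hC.hom_self
  comp x y z := (mul_comm _ _).trans_le (hC.comp z y x)

/-- The join of the identity weighted by the `Q`-valued lower bounds of `S` is the weighted meet
of `S`. -/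
theorem IsWeightedJoin.isWeightedMeet {Q : Type v} [CompleteLattice Q] [CommMonoid Q]
    [IsQuantale Q] {A : Type u} {hom : A → A → Q} (hC : IsQCategory hom) {ι : Type w}
    {S : ι → A} {W : ι → Q} {j : A}
    (hj : IsWeightedJoin hom (fun a : A => a) (fun x => ⨅ c, qhom (W c) (hom x (S c))) j) :
    IsWeightedMeet hom S W j := by
  intro x
  apply le_antisymm
  · refine le_iInf fun c => le_qhom_iff.2 ?_
    have hW : W c ≤ hom j (S c) := by
      rw [hj (S c)]
      refine le_iInf fun a => le_qhom_iff.2 ?_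
      rw [mul_comm]
      exact le_qhom_iff.1 (iInf_le _ c)
    calc W c * hom x j ≤ hom j (S c) * hom x j := by gcongr
      _ = hom x j * hom j (S c) := mul_comm _ _
      _ ≤ hom x (S c) := hC.comp _ _ _
  · have h := (hC.hom_self j).symm.trans (hj j) |>.le.trans (iInf_le _ x)
    simpa using le_qhom_iff.1 h

theorem HasAllWeightedJoins.hasAllWeightedMeets {Q : Type v} [CompleteLattice Q] [CommMonoid Q]
    [IsQuantale Q] {A : Type u} {hom : A → A → Q} (hC : IsQCategory hom)
    (h : HasAllWeightedJoins hom) : HasAllWeightedMeets hom := fun _ _ _ =>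
  (h A _ _).imp fun _ hj => hj.isWeightedMeet hC

/-- If the join of the identity of `C` weighted by
`V x := ⨅ c, [W c, hom x (S c)]` exists, then it satisfies the universal property of the meet of
`S` weighted by `W`.  Consequently a `Q`-category with all weighted joins has all weighted meets,
and dually. -/
theorem weighted_meet_from_weighted_join
    {Q : Type v} [CompleteLattice Q] [CommMonoid Q] [IsQuantale Q]
    (hsc : ∀ p q : Q, p * q ≤ p ⊓ q)
    {A : Type u} {hom : A → A → Q} (hC : IsQCategory hom)
    {ι : Type w} (S : ι → A) (W : ι → Q)
    (V : A → Q) (hV : ∀ x, V x = ⨅ c, qhom (W c) (hom x (S c)))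
    (j : A) (hj : IsWeightedJoin hom (fun a : A => a) V j) :
    IsWeightedMeet hom S W j ∧
      (HasAllWeightedJoins hom → HasAllWeightedMeets hom) ∧
      (HasAllWeightedMeets hom → HasAllWeightedJoins hom) := by
  obtain rfl : V = fun x => ⨅ c, qhom (W c) (hom x (S c)) := funext hV
  exact ⟨hj.isWeightedMeet hC, HasAllWeightedJoins.hasAllWeightedMeets hC,
    HasAllWeightedJoins.hasAllWeightedMeets (hom := fun x y => hom y x) hC.op⟩
end

section
/- Let C be a Q-category, L : C → C a Q-functor, and q ∈ Q. Suppose S : 𝒮 → ob(C) and W : 𝒮 → Q are functions such that every S(c) is a q-suffix point of L, i.e. q ≤ hom_C(S(c), L(S(c))) for all c ∈ 𝒮, and suppose the weighted join ⋁^W S exists in C. Then ⋁^W S is also a q-suffix point of L: q ≤ hom_C(⋁^W S, L(⋁^W S)). Dually, if every S(c) satisfies q ≤ hom_C(L(S(c)), S(c)) (is a q-prefix point) and the weighted meet ⋀^W S exists, then q ≤ hom_C(L(⋀^W S), ⋀^W S). -/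
/- `Q` is a commutative unital quantale: `[CommMonoid Q] [CompleteLattice Q] [IsQuantale Q]`
(Mathlib's `IsQuantale` says multiplication distributes over arbitrary suprema).
Semicartesianness (`∀ p q, p * q ≤ p ⊓ q`) is taken as an explicit hypothesis where needed. -/

universe u v w

/-- Evaluation (modus ponens) for the internal hom of a quantale. -/
theorem mul_qhom_le {Q : Type v} [CompleteLattice Q] [CommMonoid Q] [IsQuantale Q] (p q : Q) :
    p * qhom p q ≤ q := by
  rw [qhom, IsQuantale.mul_sSup_distrib]
  exact iSup₂_le fun _ hr => hr

theorem le_qhom {Q : Type v} [CompleteLattice Q] [Mul Q] {p q r : Q} (h : p * r ≤ q) :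
    r ≤ qhom p q :=
  le_sSup h

theorem le_of_one_le_qhom {Q : Type v} [CompleteLattice Q] [CommMonoid Q] [IsQuantale Q]
    {p q : Q} (h : 1 ≤ qhom p q) : p ≤ q :=
  calc p = p * 1 := (mul_one p).symm
    _ ≤ p * qhom p q := mul_le_mul_right h p
    _ ≤ q := mul_qhom_le p q

/-- The weight of a weighted join bounds the homs of its cocone. -/
theorem IsWeightedJoin.weight_le {Q : Type v} [CompleteLattice Q] [CommMonoid Q] [IsQuantale Q]
    {A : Type u} {hom : A → A → Q} (hC : IsQCategory hom) {ι : Type w} {S : ι → A} {W : ι → Q}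
    {j : A} (hj : IsWeightedJoin hom S W j) (c : ι) : W c ≤ hom (S c) j :=
  le_of_one_le_qhom (by rw [← hC.hom_self j, hj j]; exact iInf_le _ c)

/-- The weight of a weighted meet bounds the homs of its cone. -/
theorem IsWeightedMeet.weight_le {Q : Type v} [CompleteLattice Q] [CommMonoid Q] [IsQuantale Q]
    {A : Type u} {hom : A → A → Q} (hC : IsQCategory hom) {ι : Type w} {S : ι → A} {W : ι → Q}
    {m : A} (hm : IsWeightedMeet hom S W m) (c : ι) : W c ≤ hom m (S c) :=
  le_of_one_le_qhom (by rw [← hC.hom_self m, hm m]; exact iInf_le _ c)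

/-- For a `Q`-endofunctor `L`, a weighted join of `q`-suffix points of `L` is a
`q`-suffix point, and dually a weighted meet of `q`-prefix points is a `q`-prefix point. -/
theorem suffix_points_closed_under_weighted_joins
    {Q : Type v} [CompleteLattice Q] [CommMonoid Q] [IsQuantale Q]
    (hsc : ∀ p q : Q, p * q ≤ p ⊓ q)
    {A : Type u} {hom : A → A → Q} (hC : IsQCategory hom)
    (L : A → A) (hL : ∀ x y, hom x y ≤ hom (L x) (L y)) (q : Q)
    {ι : Type w} (S : ι → A) (W : ι → Q) :
    ((∀ c, q ≤ hom (S c) (L (S c))) →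
      ∀ j, IsWeightedJoin hom S W j → q ≤ hom j (L j)) ∧
    ((∀ c, q ≤ hom (L (S c)) (S c)) →
      ∀ m, IsWeightedMeet hom S W m → q ≤ hom (L m) m) := by
  refine ⟨fun hS j hj => ?_, fun hS m hm => ?_⟩
  · rw [hj (L j)]
    refine le_iInf fun c => le_qhom ?_
    rw [mul_comm]
    calc q * W c ≤ hom (S c) (L (S c)) * hom (L (S c)) (L j) :=
          mul_le_mul' (hS c) ((hj.weight_le hC c).trans (hL _ _))
      _ ≤ hom (S c) (L j) := hC.comp _ _ _
  · rw [hm (L m)]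
    refine le_iInf fun c => le_qhom ?_
    calc W c * q ≤ hom (L m) (L (S c)) * hom (L (S c)) (S c) :=
          mul_le_mul' ((hm.weight_le hC c).trans (hL _ _)) (hS c)
      _ ≤ hom (L m) (S c) := hC.comp _ _ _
end

section
/- Let F : C → D and G : D → C be Q-functors and q ∈ Q. Then F and G form a q-fuzzy Q-adjunction, i.e. for all x ∈ C and y ∈ D both q ≤ [hom_D(F x, y), hom_C(x, G y)] and q ≤ [hom_C(x, G y), hom_D(F x, y)], if and only if q ≤ hom_C(x, G(F x)) for all x ∈ C and q ≤ hom_D(F(G y), y) for all y ∈ D. -/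
/- `Q` is a commutative unital quantale: `[CommMonoid Q] [CompleteLattice Q] [IsQuantale Q]`
(Mathlib's `IsQuantale` says multiplication distributes over arbitrary suprema).
Semicartesianness (`∀ p q, p * q ≤ p ⊓ q`) is taken as an explicit hypothesis where needed. -/

universe u v w

/-- `Q`-functors `F ⊣ G` form a `q`-fuzzy `Q`-adjunction iff the unit and counit
conditions `q ≤ hom x (G (F x))` and `q ≤ hom (F (G y)) y` hold. -/
theorem fuzzy_adjunction_iff_unit_counit
    {Q : Type v} [CompleteLattice Q] [CommMonoid Q] [IsQuantale Q]
    (hsc : ∀ p q : Q, p * q ≤ p ⊓ q)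
    {A : Type u} {B : Type w} {homC : A → A → Q} {homD : B → B → Q}
    (hC : IsQCategory homC) (hD : IsQCategory homD)
    (F : A → B) (hF : ∀ x y, homC x y ≤ homD (F x) (F y))
    (G : B → A) (hG : ∀ x y, homD x y ≤ homC (G x) (G y)) (q : Q) :
    (∀ (x : A) (y : B),
        q ≤ qhom (homD (F x) y) (homC x (G y)) ∧ q ≤ qhom (homC x (G y)) (homD (F x) y)) ↔
      ((∀ x, q ≤ homC x (G (F x))) ∧ (∀ y, q ≤ homD (F (G y)) y)) := by
  simp only [le_qhom_iff]
  constructor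
  · intro h
    refine ⟨fun x => ?_, fun y => ?_⟩
    · simpa [hD.hom_self] using (h x (F x)).1
    · simpa [hC.hom_self] using (h (G y) y).2
  · rintro ⟨hunit, hcounit⟩ x y
    constructor
    · calc homD (F x) y * q = q * homD (F x) y := mul_comm _ _
        _ ≤ homC x (G (F x)) * homC (G (F x)) (G y) := mul_le_mul' (hunit x) (hG _ _)
        _ ≤ homC x (G y) := hC.comp _ _ _
    · calc homC x (G y) * q ≤ homD (F x) (F (G y)) * homD (F (G y)) y :=
          mul_le_mul' (hF _ _) (hcounit y)
        _ ≤ homD (F x) y := hD.comp _ _ _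
end

section
/- Let L_W be an ε-fuzzy Lawvere Laplacian and q ∈ Q. If x ∈ C⁰F is a q-suffix point of L_W, i.e. q ≤ hom_{C⁰F}(x, L_W x), then for every edge e and every ordered pair of its endpoints v, w one has W(v,w)·ε·q ≤ hom_{Fe}(F_{v◁e} x_v, F_{w◁e} x_w). -/
/- `Q` is a commutative unital quantale: `[CommMonoid Q] [CompleteLattice Q] [IsQuantale Q]`
(Mathlib's `IsQuantale` says multiplication distributes over arbitrary suprema).
Semicartesianness (`∀ p q, p * q ≤ p ⊓ q`) is taken as an explicit hypothesis where needed. -/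

universe u v w

section Lap

variable (Q : Type v) [CompleteLattice Q] [CommMonoid Q]

/-- A network sheaf/cosheaf pair on a finite simple undirected graph `G = (V,E)`:
weighted-lattice stalks `Fv`, `Fe` over vertices and edges, restriction `Q`-functors
`F_{v◁e} : Fv → Fe` and extension `Q`-functors `F̄_{e▷v} : Fe → Fv` for each incidence
`v ◁ e` (i.e. `v ∈ ∂e`). -/
structure LapSetup where
  /-- vertices -/
  V : Type u
  /-- edges -/
  E : Type u
  finV : Finite V
  finE : Finite E
  /-- `incid e v` means `v ◁ e`, i.e. `v ∈ ∂e` -/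
  incid : E → V → Prop
  /-- every edge has exactly two distinct endpoints -/
  two_ends : ∀ e : E, ∃ v w : V, v ≠ w ∧ ∀ u, incid e u ↔ (u = v ∨ u = w)
  /-- the graph is simple: an edge is determined by its endpoints -/
  simple : ∀ e e' : E, (∀ v, incid e v ↔ incid e' v) → e = e'
  /-- vertex stalks -/
  Fv : V → Type u
  /-- edge stalks -/
  Fe : E → Type u
  homV : ∀ v, Fv v → Fv v → Q
  homE : ∀ e, Fe e → Fe e → Q
  catV : ∀ v, IsQCategory (homV v)
  catE : ∀ e, IsQCategory (homE e)
  meetsV : ∀ v, HasAllWeightedMeets (homV v)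
  joinsV : ∀ v, HasAllWeightedJoins (homV v)
  meetsE : ∀ e, HasAllWeightedMeets (homE e)
  joinsE : ∀ e, HasAllWeightedJoins (homE e)
  /-- restriction `F_{v◁e} : Fv → Fe` -/
  res : ∀ {e v}, incid e v → Fv v → Fe e
  /-- extension `F̄_{e▷v} : Fe → Fv` -/
  ext : ∀ {e v}, incid e v → Fe e → Fv v
  res_functor : ∀ {e v} (h : incid e v) (a b : Fv v), homV v a b ≤ homE e (res h a) (res h b)
  ext_functor : ∀ {e v} (h : incid e v) (a b : Fe e), homE e a b ≤ homV v (ext h a) (ext h b)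

variable {Q}

/-- 0-cochains `C⁰F = ∏_v Fv`. -/
abbrev Cochain (D : LapSetup Q) : Type u := ∀ v : D.V, D.Fv v

/-- The hom of the product `Q`-category `C⁰F`. -/
def C0hom (D : LapSetup Q) (x y : Cochain D) : Q := ⨅ v, D.homV v (x v) (y v)

/-- The index of the neighborhood family at `v`: pairs `(e, w)` with `v ◁ e ▷ w` and `w ≠ v`. -/
def NbIdx (D : LapSetup Q) (v : D.V) : Type u :=
  {p : D.E × D.V // D.incid p.1 v ∧ D.incid p.1 p.2 ∧ p.2 ≠ v}

/-- `L` is a Lawvere Laplacian for `D` weighted by `W`: for every cochain `x` and vertex `v`,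
`(L x)_v` is the meet of the family `F̄_{e▷v} (F_{w◁e} x_w)` (over `w ∈ N_v`, `∂e = {v,w}`)
weighted by `W(v,-)`. -/
def IsLawvereLaplacian (D : LapSetup Q) (W : D.V → D.V → Q)
    (L : Cochain D → Cochain D) : Prop :=
  ∀ (x : Cochain D) (v : D.V),
    IsWeightedMeet (D.homV v)
      (fun p : NbIdx D v => D.ext p.2.1 (D.res p.2.2.1 (x p.1.2)))
      (fun p => W v p.1.2) (L x v)

/-- The Laplacian data is `ε`-fuzzy: each restriction/extension pair `F_{v◁e} ⊣_ε F̄_{e▷v}`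
is an `ε`-fuzzy adjunction. -/
def IsFuzzyLap (D : LapSetup Q) (ε : Q) : Prop :=
  ∀ {e : D.E} {v : D.V} (h : D.incid e v) (a : D.Fv v) (b : D.Fe e),
    ε ≤ qhom (D.homE e (D.res h a) b) (D.homV v a (D.ext h b)) ∧
    ε ≤ qhom (D.homV v a (D.ext h b)) (D.homE e (D.res h a) b)

/-- The Laplacian data is crisp: each restriction/extension pair is a genuine `Q`-adjunction. -/
def IsCrispLap (D : LapSetup Q) : Prop :=
  ∀ {e : D.E} {v : D.V} (h : D.incid e v) (a : D.Fv v) (b : D.Fe e),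
    D.homE e (D.res h a) b = D.homV v a (D.ext h b)

/-- `x` is a `W`-fuzzy global section. -/
def IsGlobalSection (D : LapSetup Q) (W : D.V → D.V → Q) (x : Cochain D) : Prop :=
  ∀ {e : D.E} {v w : D.V} (hv : D.incid e v) (hw : D.incid e w), v ≠ w →
    W v w ≤ D.homE e (D.res hv (x v)) (D.res hw (x w))

end Lap

/-- Residuation for the internal hom of a quantale. -/
theorem mul_le_of_le_qhom {Q : Type v} [CompleteLattice Q] [CommMonoid Q] [IsQuantale Q]
    {p r q : Q} (h : r ≤ qhom p q) : p * r ≤ q := by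
  refine (mul_le_mul_right h p).trans ?_
  rw [qhom, IsQuantale.mul_sSup_distrib]
  exact iSup₂_le fun _ hr => hr

/-- For an `ε`-fuzzy Lawvere Laplacian, a `q`-suffix point `x` satisfies
`W(v,w)·ε·q ≤ hom_{Fe}(F_{v◁e} x_v, F_{w◁e} x_w)` on every edge. -/
theorem suffix_to_section
    {Q : Type v} [CompleteLattice Q] [CommMonoid Q] [IsQuantale Q]
    (hsc : ∀ p q : Q, p * q ≤ p ⊓ q)
    (D : LapSetup Q) (W : D.V → D.V → Q) (L : Cochain D → Cochain D)
    (hL : IsLawvereLaplacian D W L) (ε q : Q) (hε : IsFuzzyLap D ε)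
    (x : Cochain D) (hx : q ≤ C0hom D x (L x)) :
    ∀ {e : D.E} {v w : D.V} (hv : D.incid e v) (hw : D.incid e w), v ≠ w →
      W v w * ε * q ≤ D.homE e (D.res hv (x v)) (D.res hw (x w)) := by
  intro e v w hv hw hvw
  have hmeet : q ≤ qhom (W v w) (D.homV v (x v) (D.ext hv (D.res hw (x w)))) := by
    refine (hx.trans (iInf_le _ v)).trans ?_
    rw [hL x v (x v)]
    exact iInf_le _ (⟨(e, w), hv, hw, hvw.symm⟩ : NbIdx D v)
  calc W v w * ε * q = ε * (W v w * q) := by rw [mul_comm (W v w) ε, mul_assoc]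
    _ ≤ ε * D.homV v (x v) (D.ext hv (D.res hw (x w))) :=
      mul_le_mul_right (mul_le_of_le_qhom hmeet) ε
    _ = D.homV v (x v) (D.ext hv (D.res hw (x w))) * ε := mul_comm _ _
    _ ≤ D.homE e (D.res hv (x v)) (D.res hw (x w)) :=
      mul_le_of_le_qhom (hε hv (x v) (D.res hw (x w))).2
end

section
/- Hodge-type theorem for the crisp Lawvere Laplacian: if L_W is a crisp (1-fuzzy) Lawvere Laplacian, then x ∈ C⁰F satisfies 1 ≤ hom_{C⁰F}(x, L_W x) if and only if x is a W-fuzzy global section, i.e. W(v,w) ≤ hom_{Fe}(F_{v◁e} x_v, F_{w◁e} x_w) for every edge e and every ordered pair of its endpoints v, w. Consequently the Q-category of suffix points S(L_W) (with hom inherited from C⁰F) is isomorphic to the Q-category of W-fuzzy global sections with hom(x,y) = ⨅_{v∈V} hom_{Fv}(x_v, y_v). -/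
/- `Q` is a commutative unital quantale: `[CommMonoid Q] [CompleteLattice Q] [IsQuantale Q]`
(Mathlib's `IsQuantale` says multiplication distributes over arbitrary suprema).
Semicartesianness (`∀ p q, p * q ≤ p ⊓ q`) is taken as an explicit hypothesis where needed. -/

universe u v w

theorem one_le_qhom_iff {Q : Type v} [CompleteLattice Q] [CommMonoid Q] [IsQuantale Q] {p q : Q} :
    1 ≤ qhom p q ↔ p ≤ q := by
  rw [le_qhom_iff, mul_one]

/-- A cochain is a suffix point iff each weight is bounded by the hom into the corresponding
neighbor term. -/
theorem IsLawvereLaplacian.one_le_C0hom_iff {Q : Type v} [CompleteLattice Q] [CommMonoid Q]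
    [IsQuantale Q] {D : LapSetup Q} {W : D.V → D.V → Q} {L : Cochain D → Cochain D}
    (hL : IsLawvereLaplacian D W L) (x : Cochain D) :
    1 ≤ C0hom D x (L x) ↔ ∀ (v : D.V) (p : NbIdx D v),
      W v p.1.2 ≤ D.homV v (x v) (D.ext p.2.1 (D.res p.2.2.1 (x p.1.2))) := by
  rw [C0hom, le_iInf_iff]
  refine forall_congr' fun v => ?_
  rw [hL x v (x v), le_iInf_iff]
  exact forall_congr' fun p => one_le_qhom_iff

/-- **Hodge-type theorem.** For a crisp Lawvere Laplacian, `x` is a suffix point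
(`1 ≤ hom_{C⁰F}(x, L_W x)`) iff `x` is a `W`-fuzzy global section.  Consequently the category of
suffix points (hom inherited from `C⁰F`) coincides — identity on objects, with equal homs — with
the `Q`-category of `W`-fuzzy global sections. -/
theorem crisp_suffix_iff_global_section
    {Q : Type v} [CompleteLattice Q] [CommMonoid Q] [IsQuantale Q]
    (hsc : ∀ p q : Q, p * q ≤ p ⊓ q)
    (D : LapSetup Q) (W : D.V → D.V → Q) (L : Cochain D → Cochain D)
    (hL : IsLawvereLaplacian D W L) (hcrisp : IsCrispLap D) :
    (∀ x : Cochain D, 1 ≤ C0hom D x (L x) ↔ IsGlobalSection D W x) ∧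
    {x : Cochain D | 1 ≤ C0hom D x (L x)} = {x : Cochain D | IsGlobalSection D W x} ∧
    (∀ x y : Cochain D, C0hom D x y = ⨅ v, D.homV v (x v) (y v)) := by
  have key (x : Cochain D) : 1 ≤ C0hom D x (L x) ↔ IsGlobalSection D W x := by
    rw [hL.one_le_C0hom_iff]
    constructor
    · intro h e v w hv hw hvw
      rw [hcrisp]
      exact h v ⟨(e, w), hv, hw, hvw.symm⟩
    · rintro h v ⟨⟨e, w⟩, hv, hw, hwv⟩
      rw [← hcrisp]
      exact h hv hw hwv.symm
  exact ⟨key, Set.ext key, fun _ _ => rfl⟩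
end

section
/- Let L_W be a crisp Lawvere Laplacian and define the unweighted harmonic flow x[t+1] := x[t] ∧ L_W(x[t]) (crisp binary meet in C⁰F) from an initial cochain x[0]. Suppose the flow converges in finitely many iterations, i.e. there is T with x[T] ≈₁ x[T+1] (so x[T] is a fixed point x[∞]). Then for every W-fuzzy global section y of F one has hom_{C⁰F}(y, x[0]) = hom_{C⁰F}(y, x[∞]). -/
/- `Q` is a commutative unital quantale: `[CommMonoid Q] [CompleteLattice Q] [IsQuantale Q]`
(Mathlib's `IsQuantale` says multiplication distributes over arbitrary suprema).
Semicartesianness (`∀ p q, p * q ≤ p ⊓ q`) is taken as an explicit hypothesis where needed. -/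

universe u v w

/-- A Lawvere Laplacian does not decrease the hom from a fuzzy global section. -/
theorem IsGlobalSection.hom_le_hom_laplacian
    {Q : Type v} [CompleteLattice Q] [CommMonoid Q] [IsQuantale Q]
    {D : LapSetup Q} {W : D.V → D.V → Q} {L : Cochain D → Cochain D}
    (hL : IsLawvereLaplacian D W L) (hcrisp : IsCrispLap D)
    {y : Cochain D} (hy : IsGlobalSection D W y) (x : Cochain D) :
    C0hom D y x ≤ C0hom D y (L x) := by
  refine le_iInf fun v => ?_
  rw [hL x v]
  refine le_iInf fun ⟨⟨e, w⟩, hv, hw, hne⟩ => le_qhom ?_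
  rw [← hcrisp]
  calc W v w * C0hom D y x
      ≤ D.homE e (D.res hv (y v)) (D.res hw (y w)) *
          D.homE e (D.res hw (y w)) (D.res hw (x w)) :=
        mul_le_mul' (hy hv hw hne.symm) ((iInf_le _ w).trans (D.res_functor hw _ _))
    _ ≤ D.homE e (D.res hv (y v)) (D.res hw (x w)) := (D.catE e).comp _ _ _

/-- Let `L_W` be a crisp Lawvere Laplacian and let `xs` be the unweighted
harmonic flow `xs (t+1) = xs t ∧ L_W (xs t)` (crisp binary meet in `C⁰F`, characterized by its
universal property) started at `xs 0`.  If the flow converges at time `T` (i.e. `xs T ≈₁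
xs (T+1)`), then `hom_{C⁰F}(y, xs 0) = hom_{C⁰F}(y, xs T)` for every `W`-fuzzy global
section `y`. -/
theorem harmonic_flow_preserves_hom_from_sections
    {Q : Type v} [CompleteLattice Q] [CommMonoid Q] [IsQuantale Q]
    (hsc : ∀ p q : Q, p * q ≤ p ⊓ q)
    (D : LapSetup Q) (W : D.V → D.V → Q) (L : Cochain D → Cochain D)
    (hL : IsLawvereLaplacian D W L) (hcrisp : IsCrispLap D)
    (xs : ℕ → Cochain D)
    (hflow : ∀ (t : ℕ) (z : Cochain D),
      C0hom D z (xs (t + 1)) = C0hom D z (xs t) ⊓ C0hom D z (L (xs t)))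
    (T : ℕ)
    (hconv : 1 ≤ C0hom D (xs T) (xs (T + 1)) ⊓ C0hom D (xs (T + 1)) (xs T))
    (y : Cochain D) (hy : IsGlobalSection D W y) :
    C0hom D y (xs 0) = C0hom D y (xs T) := by
  clear hconv
  induction T with
  | zero => rfl
  | succ t ih => rw [hflow, inf_eq_left.2 (hy.hom_le_hom_laplacian hL hcrisp _), ih]
end

section
/- Let F : C → D and G : D → C be q-fuzzy Q-adjoints, i.e. Q-functors with q ≤ [hom_D(F x, y), hom_C(x, G y)] and q ≤ [hom_C(x, G y), hom_D(F x, y)] for all x ∈ C, y ∈ D. Let S : 𝒮 → ob(D) and W : 𝒮 → Q be such that the weighted meets ⋀^W S in D and ⋀^W (G∘S) in C exist. Then G(⋀^W S) ≈_{q·q} ⋀^W (G∘S), i.e. q·q ≤ hom_C(G(⋀^W S), ⋀^W(G∘S)) ⊓ hom_C(⋀^W(G∘S), G(⋀^W S)). Dually, F preserves weighted joins up to q·q: F(⋁^W S) ≈_{q·q} ⋁^W (F∘S) whenever both joins exist. -/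
/- `Q` is a commutative unital quantale: `[CommMonoid Q] [CompleteLattice Q] [IsQuantale Q]`
(Mathlib's `IsQuantale` says multiplication distributes over arbitrary suprema).
Semicartesianness (`∀ p q, p * q ≤ p ⊓ q`) is taken as an explicit hypothesis where needed. -/

universe u v w

/-- The case of weighted meets; the case of weighted joins is its dual. -/
theorem mul_self_le_of_isWeightedMeet
    {Q : Type*} [CompleteLattice Q] [CommMonoid Q] [IsQuantale Q]
    (hsc : ∀ p q : Q, p * q ≤ p ⊓ q)
    {A B : Type*} {homC : A → A → Q} {homD : B → B → Q}
    (hC : ∀ x, homC x x = 1) (hD : ∀ y, homD y y = 1)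
    (F : A → B) (G : B → A) (hG : ∀ x y, homD x y ≤ homC (G x) (G y)) (q : Q)
    (hFG : ∀ x y, homD (F x) y * q ≤ homC x (G y))
    (hGF : ∀ x y, homC x (G y) * q ≤ homD (F x) y)
    {ι : Type*} {S : ι → B} {W : ι → Q} {m : B} {m' : A}
    (hm : IsWeightedMeet homD S W m) (hm' : IsWeightedMeet homC (fun c => G (S c)) W m') :
    q * q ≤ homC (G m) m' ⊓ homC m' (G m) := by
  have cone : ∀ c, W c ≤ homD m (S c) := fun c => by
    have h : (1 : Q) ≤ qhom (W c) (homD m (S c)) := by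
      rw [← hD m, hm m]
      exact iInf_le _ c
    simpa using le_qhom_iff.1 h
  have cone' : ∀ c, W c ≤ homC m' (G (S c)) := fun c => by
    have h : (1 : Q) ≤ qhom (W c) (homC m' (G (S c))) := by
      rw [← hC m', hm' m']
      exact iInf_le _ c
    simpa using le_qhom_iff.1 h
  refine le_inf ?_ ?_
  · rw [hm']
    refine le_iInf fun c => le_qhom_iff.2 ?_
    exact ((hsc _ _).trans inf_le_left).trans ((cone c).trans (hG _ _))
  · have hq : q ≤ homD (F m') m := by
      rw [hm]
      exact le_iInf fun c => le_qhom_iff.2 ((mul_le_mul_left (cone' c) q).trans (hGF _ _))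
    exact (mul_le_mul_left hq q).trans (hFG _ _)

/-- `q`-fuzzy `Q`-adjoints preserve weighted (co)limits up to `q·q`:
`G (⋀^W S) ≈_{q·q} ⋀^W (G∘S)` and dually `F (⋁^W S) ≈_{q·q} ⋁^W (F∘S)`, whenever the relevant
weighted meets/joins exist. -/
theorem fuzzy_adjoints_preserve_weighted_limits
    {Q : Type v} [CompleteLattice Q] [CommMonoid Q] [IsQuantale Q]
    (hsc : ∀ p q : Q, p * q ≤ p ⊓ q)
    {A : Type u} {B : Type w} {homC : A → A → Q} {homD : B → B → Q}
    (hC : IsQCategory homC) (hD : IsQCategory homD)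
    (F : A → B) (hF : ∀ x y, homC x y ≤ homD (F x) (F y))
    (G : B → A) (hG : ∀ x y, homD x y ≤ homC (G x) (G y)) (q : Q)
    (hadj : ∀ (x : A) (y : B),
      q ≤ qhom (homD (F x) y) (homC x (G y)) ∧ q ≤ qhom (homC x (G y)) (homD (F x) y)) :
    (∀ {ι : Type*} (S : ι → B) (W : ι → Q) (m : B) (m' : A),
      IsWeightedMeet homD S W m → IsWeightedMeet homC (fun c => G (S c)) W m' →
      q * q ≤ homC (G m) m' ⊓ homC m' (G m)) ∧
    (∀ {ι : Type*} (S : ι → A) (W : ι → Q) (j : A) (j' : B),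
      IsWeightedJoin homC S W j → IsWeightedJoin homD (fun c => F (S c)) W j' →
      q * q ≤ homD (F j) j' ⊓ homD j' (F j)) := by
  have hFG x y := le_qhom_iff.1 (hadj x y).1
  have hGF x y := le_qhom_iff.1 (hadj x y).2
  refine ⟨fun S W m m' hm hm' =>
    mul_self_le_of_isWeightedMeet hsc hC.hom_self hD.hom_self F G hG q hFG hGF hm hm',
    fun S W j j' hj hj' => ?_⟩
  rw [inf_comm]
  exact mul_self_le_of_isWeightedMeet (homC := fun x y => homD y x) (homD := fun x y => homC y x)
    hsc hD.hom_self hC.hom_self G F (fun x y => hF y x) q (fun x y => hGF y x)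
    (fun x y => hFG y x) hj hj'
end
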